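/- Fix a > 0, γ ∈ [1,2], ν > 0, and constants ς̄₀ > 0 and Ē > 0. There exist positive constants C and α, depending only on (a, γ, ν, ς̄₀, Ē), with the following property: for every global smooth solution (η, w) of the 1D isentropic compressible Navier–Stokes system on [0,∞) × T whose initial data satisfy 0 < η₀ ≤ ς̄₀, ∫_T η₀ dx = 1, ∫_T η₀ w₀ dx = 0 and E₀₀ := ∫_T ( (1/2) η₀ w₀² + P(η₀) ) dx ≤ Ē, one has for all t ≥ 0: ( ∫_T η w²(t,x) dx )^{1/2} + ( ∫_T (η(t,x) − 1)² dx )^{1/2} ≤ C E₀₀^{1/2} e^{−α t}. -/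

import Mathlib

open MeasureTheory

/-- The pressure potential `P` associated with the pressure law `p(s) = a s^γ`:
`P(s) = a s^γ/(γ-1)` if `γ > 1` and `P(s) = a (s log s + 1)` if `γ = 1`. -/
noncomputable def Ppot (a γ : ℝ) (s : ℝ) : ℝ :=
  if γ = 1 then a * (s * Real.log s + 1) else a * s ^ γ / (γ - 1)

/-- The derivative of the pressure potential. -/
noncomputable def enthalpy (a γ : ℝ) (s : ℝ) : ℝ :=
  if γ = 1 then a * (Real.log s + 1) else a * γ * s ^ (γ - 1) / (γ - 1)

lemma hasDerivAt_Ppot (a γ : ℝ) {s : ℝ} (hs : 0 < s) :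
    HasDerivAt (Ppot a γ) (enthalpy a γ s) s := by
  unfold Ppot enthalpy
  split_ifs with h
  · have := (((hasDerivAt_id s).mul (Real.hasDerivAt_log hs.ne')).add_const 1).const_mul a
    refine this.congr_deriv ?_
    simp only [id]
    field_simp
  · have := ((Real.hasDerivAt_rpow_const (p := γ) (Or.inl hs.ne')).const_mul a).div_const (γ - 1)
    exact this.congr_deriv (by ring)

lemma hasDerivAt_enthalpy (a γ : ℝ) {s : ℝ} (hs : 0 < s) :
    HasDerivAt (enthalpy a γ) (a * γ * s ^ (γ - 2)) s := by
  unfold enthalpy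
  split_ifs with h
  · have := ((Real.hasDerivAt_log hs.ne').add_const 1).const_mul a
    refine this.congr_deriv ?_
    rw [h, show (1 - 2 : ℝ) = -1 by norm_num, Real.rpow_neg_one]
    ring
  · have := ((Real.hasDerivAt_rpow_const (p := γ - 1) (Or.inl hs.ne')).const_mul
      (a * γ)).div_const (γ - 1)
    refine this.congr_deriv ?_
    have h' : γ - 1 ≠ 0 := sub_ne_zero.mpr h
    rw [show γ - 1 - 1 = γ - 2 by ring]
    field_simp

lemma pressure_le_Ppot {a γ s : ℝ} (ha : 0 < a) (hγ1 : 1 ≤ γ) (hγ2 : γ ≤ 2) (hs : 0 < s) :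
    a * s ^ γ ≤ Ppot a γ s := by
  unfold Ppot
  split_ifs with h
  · have h1 := Real.one_sub_inv_le_log_of_pos hs
    have h2 : s * (1 - s⁻¹) ≤ s * Real.log s := mul_le_mul_of_nonneg_left h1 hs.le
    have h3 : s * (1 - s⁻¹) = s - 1 := by field_simp
    rw [h, Real.rpow_one]
    exact mul_le_mul_of_nonneg_left (by linarith) ha.le
  · have h' : 0 < γ - 1 := sub_pos.mpr (lt_of_le_of_ne hγ1 (Ne.symm h))
    rw [le_div_iff₀ h']
    have : 0 < a * s ^ γ := by positivity
    nlinarith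

lemma rpow_le_interp {γ s : ℝ} (hγ1 : 1 ≤ γ) (hγ2 : γ ≤ 2) (hs : 0 < s) :
    s ^ γ ≤ s + (γ - 1) * (s * (s - 1)) := by
  have h := Real.geom_mean_le_arith_mean2_weighted (w₁ := 2 - γ) (w₂ := γ - 1)
    (by linarith) (by linarith) hs.le (sq_nonneg s) (by ring)
  rw [← Real.rpow_natCast s 2, ← Real.rpow_mul hs.le, ← Real.rpow_add hs] at h
  have e : 2 - γ + ((2 : ℕ) : ℝ) * (γ - 1) = γ := by push_cast; ring
  rw [e, Real.rpow_natCast] at h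
  linarith

/-- The relative potential is at most quadratic. -/
lemma relPot_le {a γ s : ℝ} (ha : 0 < a) (hγ1 : 1 ≤ γ) (hγ2 : γ ≤ 2) (hs : 0 < s) :
    Ppot a γ s - Ppot a γ 1 - enthalpy a γ 1 * (s - 1) ≤ a * (s - 1) ^ 2 := by
  unfold Ppot enthalpy
  split_ifs with h
  · have h1 := mul_le_mul_of_nonneg_left (Real.log_le_sub_one_of_pos hs) (mul_pos ha hs).le
    simp only [Real.log_one]
    nlinarith
  · have h' : 0 < γ - 1 := sub_pos.mpr (lt_of_le_of_ne hγ1 (Ne.symm h))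
    have h1 := mul_le_mul_of_nonneg_left (rpow_le_interp hγ1 hγ2 hs) ha.le
    simp only [Real.one_rpow]
    rw [show a * s ^ γ / (γ - 1) - a * 1 / (γ - 1) - a * γ * 1 / (γ - 1) * (s - 1)
      = (a * s ^ γ - a - a * γ * (s - 1)) / (γ - 1) by field_simp, div_le_iff₀ h']
    nlinarith

/-- The relative potential is at least quadratic on bounded sets of densities. -/
lemma le_relPot {a γ s M : ℝ} (ha : 0 < a) (hγ1 : 1 ≤ γ) (hγ2 : γ ≤ 2) (hs : 0 < s)
    (hM : 1 ≤ M) (hsM : s ≤ M) :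
    a / (2 * M) * (s - 1) ^ 2 ≤ Ppot a γ s - Ppot a γ 1 - enthalpy a γ 1 * (s - 1) := by
  have hM0 : 0 < M := by linarith
  set c := a / (2 * M) with hc
  have hconv : Convex ℝ (Set.Ioc 0 M) := convex_Ioc 0 M
  have hd1 : ∀ r ∈ Set.Ioc 0 M, HasDerivAt
      (fun r => enthalpy a γ r - enthalpy a γ 1 - 2 * c * (r - 1))
      (a * γ * r ^ (γ - 2) - 2 * c) r := fun r hr => by
    have := ((hasDerivAt_enthalpy a γ hr.1).sub_const (enthalpy a γ 1)).sub
      (((hasDerivAt_id r).sub_const 1).const_mul (2 * c))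
    exact this.congr_deriv (by ring)
  have hd0 : ∀ r ∈ Set.Ioc 0 M, HasDerivAt
      (fun r => Ppot a γ r - Ppot a γ 1 - enthalpy a γ 1 * (r - 1) - c * (r - 1) ^ 2)
      (enthalpy a γ r - enthalpy a γ 1 - 2 * c * (r - 1)) r := fun r hr => by
    have := (((hasDerivAt_Ppot a γ hr.1).sub_const (Ppot a γ 1)).sub
      (((hasDerivAt_id r).sub_const 1).const_mul (enthalpy a γ 1))).sub
      ((((hasDerivAt_id r).sub_const 1).pow 2).const_mul c)
    exact this.congr_deriv (by simp; ring)
  have hmono : MonotoneOn (fun r => enthalpy a γ r - enthalpy a γ 1 - 2 * c * (r - 1))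
      (Set.Ioc 0 M) := by
    refine monotoneOn_of_deriv_nonneg hconv
      (fun r hr => (hd1 r hr).continuousAt.continuousWithinAt)
      (fun r hr => (hd1 r (interior_subset hr)).differentiableAt.differentiableWithinAt) ?_
    intro r hr
    have hr := interior_subset hr
    rw [(hd1 r hr).deriv]
    have h1 : M⁻¹ ≤ r ^ (γ - 2) := by
      calc M⁻¹ = M ^ (-1 : ℝ) := (Real.rpow_neg_one M).symm
        _ ≤ M ^ (γ - 2) := Real.rpow_le_rpow_of_exponent_le hM (by linarith)
        _ ≤ r ^ (γ - 2) := Real.rpow_le_rpow_of_nonpos hr.1 hr.2 (by linarith)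
    have h2 : 2 * c = a * M⁻¹ := by rw [hc]; field_simp
    have h3 : 0 ≤ M⁻¹ := by positivity
    rw [h2]
    have h4 : a * M⁻¹ ≤ a * r ^ (γ - 2) := mul_le_mul_of_nonneg_left h1 ha.le
    have h5 : 0 ≤ a * r ^ (γ - 2) := le_trans (by positivity) h4
    nlinarith
  have h1mem : (1 : ℝ) ∈ Set.Ioc 0 M := ⟨one_pos, hM⟩
  have key : 0 ≤ Ppot a γ s - Ppot a γ 1 - enthalpy a γ 1 * (s - 1) - c * (s - 1) ^ 2 := by
    rcases le_total 1 s with h | h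
    · have hsub : Set.Icc 1 s ⊆ Set.Ioc 0 M := fun r hr =>
        ⟨by linarith [hr.1], by linarith [hr.2]⟩
      have := monotoneOn_of_deriv_nonneg (convex_Icc 1 s)
        (fun r hr => (hd0 r (hsub hr)).continuousAt.continuousWithinAt)
        (fun r hr => (hd0 r (hsub (interior_subset hr))).differentiableAt.differentiableWithinAt)
        (fun r hr => by
          have hr := interior_subset hr
          rw [(hd0 r (hsub hr)).deriv]
          simpa using hmono h1mem (hsub hr) hr.1)
        (Set.left_mem_Icc.2 h) (Set.right_mem_Icc.2 h) h
      simpa using this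
    · have hsub : Set.Icc s 1 ⊆ Set.Ioc 0 M := fun r hr =>
        ⟨by linarith [hr.1], by linarith [hr.2]⟩
      have := antitoneOn_of_deriv_nonpos (convex_Icc s 1)
        (fun r hr => (hd0 r (hsub hr)).continuousAt.continuousWithinAt)
        (fun r hr => (hd0 r (hsub (interior_subset hr))).differentiableAt.differentiableWithinAt)
        (fun r hr => by
          have hr := interior_subset hr
          rw [(hd0 r (hsub hr)).deriv]
          simpa using hmono (hsub hr) h1mem hr.2)
        (Set.left_mem_Icc.2 h) (Set.right_mem_Icc.2 h) h
      simpa using this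
  linarith

lemma sq_le_pressure_mul {a γ s : ℝ} (ha : 0 < a) (hγ1 : 1 ≤ γ) (hs : 0 < s) :
    a * (s - 1) ^ 2 ≤ a * s ^ γ * (s - 1) - a * (s - 1) := by
  have h : 0 ≤ (s ^ γ - s) * (s - 1) := by
    rcases le_total 1 s with h | h
    · have := Real.rpow_le_rpow_of_exponent_le h hγ1
      rw [Real.rpow_one] at this
      exact mul_nonneg (by linarith) (by linarith)
    · have := Real.rpow_le_rpow_of_exponent_ge hs h hγ1
      rw [Real.rpow_one] at this
      exact mul_nonneg_of_nonpos_of_nonpos (by linarith) (by linarith)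
  nlinarith [mul_nonneg ha.le h]

/-! ### Parametric integrals -/

lemma continuous_slice {G : ℝ → ℝ → ℝ}
    (hG : ContinuousOn (Function.uncurry G) (Set.Ici 0 ×ˢ Set.univ)) {t : ℝ} (ht : 0 ≤ t) :
    Continuous (G t) := by
  have : ContinuousOn (fun x : ℝ => Function.uncurry G (t, x)) Set.univ :=
    hG.comp (by fun_prop) (fun x _ => ⟨ht, trivial⟩)
  exact continuousOn_univ.1 this

lemma continuousOn_integral_param {G : ℝ → ℝ → ℝ}
    (hG : ContinuousOn (Function.uncurry G) (Set.Ici 0 ×ˢ Set.univ)) (b c : ℝ) :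
    ContinuousOn (fun t => ∫ x in b..c, G t x) (Set.Ici 0) := by
  have h1 : Continuous (Function.uncurry fun t x => G (max t 0) x) := by
    have : ContinuousOn (fun p : ℝ × ℝ => Function.uncurry G (max p.1 0, p.2)) Set.univ :=
      hG.comp (by fun_prop) (fun p _ => ⟨le_max_right p.1 0, trivial⟩)
    exact continuousOn_univ.1 this
  have h2 : Continuous fun t => ∫ x in b..c, G (max t 0) x :=
    intervalIntegral.continuous_parametric_intervalIntegral_of_continuous' h1 b c
  refine h2.continuousOn.congr fun t ht => ?_
  have : max t 0 = t := max_eq_left ht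
  simp only [this]

lemma hasDerivAt_integral_param {G G' : ℝ → ℝ → ℝ}
    (hG : ContinuousOn (Function.uncurry G) (Set.Ici 0 ×ˢ Set.univ))
    (hG' : ContinuousOn (Function.uncurry G') (Set.Ici 0 ×ˢ Set.univ))
    (h : ∀ t x, 0 < t → HasDerivAt (fun s => G s x) (G' t x) t) {t : ℝ} (ht : 0 < t)
    (b c : ℝ) :
    HasDerivAt (fun s => ∫ x in b..c, G s x) (∫ x in b..c, G' t x) t := by
  have hK : IsCompact (Set.Icc (t / 2) (2 * t) ×ˢ Set.uIcc b c) := isCompact_Icc.prod isCompact_uIcc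
  obtain ⟨B, hB⟩ := hK.exists_bound_of_continuousOn
    (hG'.mono (Set.prod_mono (fun s hs => by
      have := hs.1; simp only [Set.mem_Ici]; linarith) (Set.subset_univ _)))
  refine (intervalIntegral.hasDerivAt_integral_of_dominated_loc_of_deriv_le (F := G) (F' := G')
    (bound := fun _ => B) (s := Set.Icc (t / 2) (2 * t))
    (Icc_mem_nhds (by linarith) (by linarith)) ?_ ?_ ?_ ?_ ?_ ?_).2
  · filter_upwards [lt_mem_nhds ht] with s hs
    exact (continuous_slice hG hs.le).aestronglyMeasurable
  · exact (continuous_slice hG ht.le).intervalIntegrable _ _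
  · exact (continuous_slice hG' ht.le).aestronglyMeasurable
  · exact ae_of_all _ fun x hx s hs => hB (s, x) ⟨hs, Set.uIoc_subset_uIcc hx⟩
  · exact intervalIntegrable_const
  · exact ae_of_all _ fun x _ s hs => h s x (by linarith [hs.1])

lemma integral_deriv_eq_zero_of_eq {f f' : ℝ → ℝ} (h : ∀ x, HasDerivAt f (f' x) x)
    (hc : Continuous f') (hp : f 1 = f 0) : ∫ x in (0 : ℝ)..1, f' x = 0 := by
  rw [intervalIntegral.integral_eq_sub_of_hasDerivAt (fun x _ => h x) (hc.intervalIntegrable _ _),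
    hp, sub_self]

/-- Cauchy-Schwarz on the unit interval. -/
lemma sq_integral_abs_le {g : ℝ → ℝ} (hg : Continuous g) :
    (∫ x in (0 : ℝ)..1, |g x|) ^ 2 ≤ ∫ x in (0 : ℝ)..1, g x ^ 2 := by
  set m := ∫ x in (0 : ℝ)..1, |g x| with hm
  have h : 0 ≤ ∫ x in (0 : ℝ)..1, (|g x| - m) ^ 2 :=
    intervalIntegral.integral_nonneg zero_le_one fun x _ => sq_nonneg _
  have e : (fun x => (|g x| - m) ^ 2) = fun x => g x ^ 2 - 2 * m * |g x| + m ^ 2 := by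
    ext x; rw [sub_sq, sq_abs]; ring
  rw [e, intervalIntegral.integral_add, intervalIntegral.integral_sub,
    intervalIntegral.integral_const_mul, ← hm] at h
  · simp at h
    nlinarith
  all_goals apply Continuous.intervalIntegrable; fun_prop

/-- The oscillation on the unit interval is bounded by the total variation. -/
lemma abs_integral_le_of_mem {g : ℝ → ℝ} (hg : Continuous g) {x y : ℝ}
    (hx : x ∈ Set.Icc (0 : ℝ) 1) (hy : y ∈ Set.Icc (0 : ℝ) 1) :
    |∫ z in x..y, g z| ≤ ∫ z in (0 : ℝ)..1, |g z| := by
  wlog hxy : x ≤ y generalizing x y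
  · rw [intervalIntegral.integral_symm, abs_neg]
    exact this hy hx (le_of_not_ge hxy)
  refine (intervalIntegral.abs_integral_le_integral_abs hxy).trans ?_
  exact intervalIntegral.integral_mono_interval hx.1 hxy hy.2
    (ae_of_all _ fun z => abs_nonneg _) (hg.abs.intervalIntegrable _ _)

/-- Weighted Poincare inequality for a weight of mean one and a function of weighted mean zero. -/
lemma weighted_sq_le {r v v' : ℝ → ℝ} (hr : Continuous r) (hr0 : ∀ x, 0 ≤ r x)
    (hv : ∀ x, HasDerivAt v (v' x) x) (hv' : Continuous v')
    (h1 : ∫ x in (0 : ℝ)..1, r x = 1) (h2 : ∫ x in (0 : ℝ)..1, r x * v x = 0) :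
    ∫ x in (0 : ℝ)..1, r x * v x ^ 2 ≤ ∫ x in (0 : ℝ)..1, v' x ^ 2 := by
  have hvc : Continuous v := continuous_iff_continuousAt.2 fun x => (hv x).continuousAt
  set m := ∫ x in (0 : ℝ)..1, |v' x| with hm
  have hosc : ∀ x ∈ Set.Icc (0 : ℝ) 1, ∀ y ∈ Set.Icc (0 : ℝ) 1, |v x - v y| ≤ m := by
    intro x hx y hy
    rw [← intervalIntegral.integral_eq_sub_of_hasDerivAt (fun z _ => hv z)
      (hv'.intervalIntegrable _ _)]
    exact abs_integral_le_of_mem hv' hy hx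
  have hb : ∀ x ∈ Set.Icc (0 : ℝ) 1, |v x| ≤ m := by
    intro x hx
    have e : ∫ y in (0 : ℝ)..1, (r y * v x - r y * v y) = v x := by
      rw [intervalIntegral.integral_sub, intervalIntegral.integral_mul_const, h1, h2]
      · ring
      all_goals apply Continuous.intervalIntegrable; fun_prop
    have e' : ∫ y in (0 : ℝ)..1, r y * m = m := by
      rw [intervalIntegral.integral_mul_const, h1, one_mul]
    rw [← e]
    conv_rhs => rw [← e']
    refine (intervalIntegral.abs_integral_le_integral_abs zero_le_one).trans ?_
    refine intervalIntegral.integral_mono_on zero_le_one ?_ ?_ fun y hy => ?_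
    · apply Continuous.intervalIntegrable; fun_prop
    · apply Continuous.intervalIntegrable; fun_prop
    · rw [← mul_sub, abs_mul, abs_of_nonneg (hr0 y)]
      exact mul_le_mul_of_nonneg_left (hosc x hx y hy) (hr0 y)
  calc ∫ x in (0 : ℝ)..1, r x * v x ^ 2 ≤ ∫ x in (0 : ℝ)..1, r x * m ^ 2 := by
        refine intervalIntegral.integral_mono_on zero_le_one ?_ ?_ fun y hy => ?_
        · apply Continuous.intervalIntegrable; fun_prop
        · apply Continuous.intervalIntegrable; fun_prop
        · exact mul_le_mul_of_nonneg_left (sq_le_sq' (neg_le_of_abs_le (hb y hy))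
            (le_of_abs_le (hb y hy))) (hr0 y)
    _ = m ^ 2 := by rw [intervalIntegral.integral_mul_const, h1, one_mul]
    _ ≤ _ := sq_integral_abs_le hv'

lemma le_initial_of_deriv_nonpos {f f' : ℝ → ℝ} (hc : ContinuousOn f (Set.Ici 0))
    (h : ∀ t, 0 < t → HasDerivAt f (f' t) t) (h' : ∀ t, 0 < t → f' t ≤ 0) {t : ℝ} (ht : 0 ≤ t) :
    f t ≤ f 0 := by
  refine antitoneOn_of_deriv_nonpos (convex_Ici 0) hc ?_ ?_ (Set.self_mem_Ici) ht ht
  · intro s hs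
    rw [interior_Ici] at hs
    exact (h s hs).differentiableAt.differentiableWithinAt
  · intro s hs
    rw [interior_Ici] at hs
    rw [(h s hs).deriv]
    exact h' s hs

lemma eq_initial_of_deriv_zero {f : ℝ → ℝ} (hc : ContinuousOn f (Set.Ici 0))
    (h : ∀ t, 0 < t → HasDerivAt f 0 t) {t : ℝ} (ht : 0 ≤ t) : f t = f 0 := by
  refine le_antisymm (le_initial_of_deriv_nonpos hc h (fun _ _ => le_rfl) ht) ?_
  have := le_initial_of_deriv_nonpos (f := fun s => -f s) (f' := fun _ => -0) hc.neg
    (fun s hs => (h s hs).neg) (fun _ _ => by simp) ht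
  linarith

/-- At a point where a function attains its maximum from the left, its derivative is nonnegative. -/
lemma deriv_nonneg_of_forall_le {f : ℝ → ℝ} {f' t : ℝ} (h : HasDerivAt f f' t) (ht : 0 < t)
    (hmax : ∀ s ∈ Set.Icc 0 t, f s ≤ f t) : 0 ≤ f' := by
  have h1 := (hasDerivWithinAt_iff_tendsto_slope' (s := Set.Iio t) (by simp)).1
    h.hasDerivWithinAt
  refine ge_of_tendsto h1 ?_
  filter_upwards [self_mem_nhdsWithin, mem_nhdsWithin_of_mem_nhds (lt_mem_nhds ht)] with s hs hs0
  rw [slope_def_field]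
  exact div_nonneg_of_nonpos (sub_nonpos.2 (hmax s ⟨le_of_lt hs0, le_of_lt hs⟩))
    (sub_nonpos.2 (le_of_lt hs))

/-- Exponential decay for an energy `E` with dissipation `D` corrected by a cross term `X`;
`K` and `N` are the kinetic and potential contributions and `P` is the ground energy. -/
lemma decay_of_corrected_energy {E D X X' K N : ℝ → ℝ} {a c δ β ν q P : ℝ}
    (hEc : ContinuousOn E (Set.Ici 0)) (hXc : ContinuousOn X (Set.Ici 0))
    (hdE : ∀ s, 0 < s → HasDerivAt E (-(ν * D s)) s) (hdX : ∀ s, 0 < s → HasDerivAt X (X' s) s)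
    (hX' : ∀ s, 0 ≤ s → a / 2 * N s - K s - q * D s ≤ X' s)
    (hX : ∀ s, 0 ≤ s → |X s| ≤ 1 / 2 * (K s + N s))
    (hlow : ∀ s, 0 ≤ s → c * N s ≤ E s - 1 / 2 * K s - P)
    (hup : ∀ s, 0 ≤ s → E s - 1 / 2 * K s - P ≤ a * N s)
    (hK : ∀ s, 0 ≤ s → 0 ≤ K s) (hN : ∀ s, 0 ≤ s → 0 ≤ N s) (hKD : ∀ s, 0 ≤ s → K s ≤ D s)
    (ha : 0 < a) (hP : 0 ≤ P) (hc : 0 < c) (hδ0 : 0 < δ) (hδ1 : δ ≤ 1 / 2) (hδc : δ ≤ c)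
    (hδν : δ * (q + 1) ≤ ν / 2) (hβ0 : 0 < β) (hβ1 : β ≤ ν / 2)
    (hβ2 : β * (a + 1) ≤ δ * a / 2) {t : ℝ} (ht : 0 ≤ t) :
    1 / 4 * K t + c / 2 * N t ≤ (2 + (a + 1) / c) * E 0 * Real.exp (-β * t) := by
  have hLup : ∀ s, 0 ≤ s → E s - P - δ * X s ≤ K s + (a + 1) * N s := fun s hs => by
    have h1 := mul_le_mul_of_nonneg_left (abs_le.1 (hX s hs)).1 hδ0.le
    have h2 := mul_nonneg (by linarith : 0 ≤ 1 - δ) (hK s hs)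
    have h3 := mul_nonneg (by linarith : 0 ≤ 2 - δ) (hN s hs)
    linarith [hup s hs]
  have hLlow : ∀ s, 0 ≤ s → 1 / 4 * K s + c / 2 * N s ≤ E s - P - δ * X s := fun s hs => by
    have h1 := mul_le_mul_of_nonneg_left (abs_le.1 (hX s hs)).2 hδ0.le
    have h2 := mul_nonneg (by linarith : 0 ≤ 1 / 2 - δ) (hK s hs)
    have h3 := mul_nonneg (by linarith : 0 ≤ c - δ) (hN s hs)
    linarith [hlow s hs]
  have hg := le_initial_of_deriv_nonpos
    (f := fun s => (E s - P - δ * X s) * Real.exp (β * s))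
    (f' := fun s => (-(ν * D s) - δ * X' s) * Real.exp (β * s)
      + (E s - P - δ * X s) * (Real.exp (β * s) * β))
    (((hEc.sub continuousOn_const).sub (continuousOn_const.mul hXc)).mul (by fun_prop))
    (fun s hs => (((hdE s hs).sub_const P).sub ((hdX s hs).const_mul δ)).mul
      (((hasDerivAt_id s).const_mul β).exp.congr_deriv (by simp)))
    (fun s hs => by
      have h0 := mul_le_mul_of_nonneg_left (hLup s hs.le) hβ0.le
      have h1 := mul_le_mul_of_nonneg_left (hX' s hs.le) hδ0.le
      have h2 := mul_nonneg (by linarith : 0 ≤ ν - δ * q) (sub_nonneg.2 (hKD s hs.le))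
      have h3 := mul_le_mul_of_nonneg_right hδν (hK s hs.le)
      have h4 := mul_le_mul_of_nonneg_right hβ1 (hK s hs.le)
      have h5 := mul_le_mul_of_nonneg_right hβ2 (hN s hs.le)
      have h6 : (-(ν * D s) - δ * X' s) + (E s - P - δ * X s) * β ≤ 0 := by linarith
      have h7 := mul_nonpos_of_nonpos_of_nonneg h6 (Real.exp_pos (β * s)).le
      linarith) ht
  simp only [mul_zero, Real.exp_zero, mul_one] at hg
  have h0 : E 0 - P - δ * X 0 ≤ (2 + (a + 1) / c) * E 0 := by
    have h1 := hlow 0 le_rfl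
    have h2 := hLup 0 le_rfl
    have h3 := mul_nonneg hc.le (hN 0 le_rfl)
    have h4 := hK 0 le_rfl
    have h5 : N 0 ≤ E 0 / c := by rw [le_div_iff₀ hc]; linarith
    have h6 := mul_le_mul_of_nonneg_left h5 (by linarith : 0 ≤ a + 1)
    have h7 : (2 + (a + 1) / c) * E 0 = 2 * E 0 + (a + 1) * (E 0 / c) := by ring
    linarith
  refine (hLlow t ht).trans ?_
  rw [neg_mul, Real.exp_neg, ← div_eq_mul_inv, le_div_iff₀ (Real.exp_pos _)]
  exact hg.trans h0

/-! ### Identities for smooth solutions -/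

/-- A classical periodic solution `(η, w)` of the isentropic Navier-Stokes system with unit mass
and zero momentum, given together with the partial derivatives entering the equations. -/
structure IsFlow (a γ ν : ℝ) (η w ηt ηx wt wx wxx : ℝ → ℝ → ℝ) : Prop where
  cont_η : Continuous (Function.uncurry η)
  cont_w : Continuous (Function.uncurry w)
  cont_ηt : Continuous (Function.uncurry ηt)
  cont_ηx : Continuous (Function.uncurry ηx)
  cont_wt : Continuous (Function.uncurry wt)
  cont_wx : Continuous (Function.uncurry wx)
  cont_wxx : Continuous (Function.uncurry wxx)
  deriv_ηt : ∀ t x, HasDerivAt (fun s => η s x) (ηt t x) t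
  deriv_ηx : ∀ t x, HasDerivAt (η t) (ηx t x) x
  deriv_wt : ∀ t x, HasDerivAt (fun s => w s x) (wt t x) t
  deriv_wx : ∀ t x, HasDerivAt (w t) (wx t x) x
  deriv_wxx : ∀ t x, HasDerivAt (wx t) (wxx t x) x
  per_η : ∀ t x, η t (x + 1) = η t x
  per_w : ∀ t x, w t (x + 1) = w t x
  pos : ∀ t x, 0 ≤ t → 0 < η t x
  mass_eq : ∀ t x, 0 ≤ t → ηt t x + (ηx t x * w t x + η t x * wx t x) = 0
  mom_eq : ∀ t x, 0 ≤ t → η t x * (wt t x + w t x * wx t x) - ν * wxx t x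
    + a * γ * η t x ^ (γ - 1) * ηx t x = 0
  mass_init : ∫ x in (0 : ℝ)..1, η 0 x = 1
  mom_init : ∫ x in (0 : ℝ)..1, η 0 x * w 0 x = 0

/-- The momentum flux `η w² - ν ∂ₓ w + a η^γ`. -/
noncomputable def momFlux (a γ ν : ℝ) (η w wx : ℝ → ℝ → ℝ) (t x : ℝ) : ℝ :=
  η t x * w t x ^ 2 - ν * wx t x + a * η t x ^ γ

namespace IsFlow

variable {a γ ν : ℝ} {η w ηt ηx wt wx wxx : ℝ → ℝ → ℝ}

lemma per_wx (h : IsFlow a γ ν η w ηt ηx wt wx wxx) (t x : ℝ) : wx t (x + 1) = wx t x := by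
  have h1 : HasDerivAt (fun y => w t (y + 1)) (wx t (x + 1)) x :=
    (h.deriv_wx t (x + 1)).comp_add_const x 1
  have h2 : (fun y => w t (y + 1)) = w t := funext fun y => h.per_w t y
  rw [h2] at h1
  exact h1.unique (h.deriv_wx t x)

lemma continuousOn_comp_η (h : IsFlow a γ ν η w ηt ηx wt wx wxx) {g : ℝ → ℝ}
    (hg : ContinuousOn g (Set.Ioi 0)) :
    ContinuousOn (fun p : ℝ × ℝ => g (η p.1 p.2)) (Set.Ici 0 ×ˢ Set.univ) :=
  hg.comp (t := Set.Ioi 0) h.cont_η.continuousOn fun p hp => h.pos p.1 p.2 hp.1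

lemma continuousOn_rpow_η (h : IsFlow a γ ν η w ηt ηx wt wx wxx) (q : ℝ) :
    ContinuousOn (fun p : ℝ × ℝ => η p.1 p.2 ^ q) (Set.Ici 0 ×ˢ Set.univ) :=
  h.continuousOn_comp_η (g := fun s => s ^ q) fun s hs =>
    (Real.continuousAt_rpow_const s q (Or.inl (ne_of_gt hs))).continuousWithinAt

lemma continuousOn_Ppot_η (h : IsFlow a γ ν η w ηt ηx wt wx wxx) :
    ContinuousOn (fun p : ℝ × ℝ => Ppot a γ (η p.1 p.2)) (Set.Ici 0 ×ˢ Set.univ) :=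
  h.continuousOn_comp_η fun _ hs => (hasDerivAt_Ppot a γ hs).continuousAt.continuousWithinAt

lemma continuousOn_enthalpy_η (h : IsFlow a γ ν η w ηt ηx wt wx wxx) :
    ContinuousOn (fun p : ℝ × ℝ => enthalpy a γ (η p.1 p.2)) (Set.Ici 0 ×ˢ Set.univ) :=
  h.continuousOn_comp_η fun _ hs => (hasDerivAt_enthalpy a γ hs).continuousAt.continuousWithinAt

lemma continuousOn_momFlux (h : IsFlow a γ ν η w ηt ηx wt wx wxx) :
    ContinuousOn (Function.uncurry (momFlux a γ ν η w wx)) (Set.Ici 0 ×ˢ Set.univ) := by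
  have := h.continuousOn_rpow_η γ
  have := h.cont_η
  have := h.cont_w
  have := h.cont_wx
  unfold momFlux Function.uncurry at *
  fun_prop

lemma per_momFlux (h : IsFlow a γ ν η w ηt ηx wt wx wxx) (t x : ℝ) :
    momFlux a γ ν η w wx t (x + 1) = momFlux a γ ν η w wx t x := by
  simp only [momFlux, h.per_η, h.per_w, h.per_wx]

lemma hasDerivAt_massFlux (h : IsFlow a γ ν η w ηt ηx wt wx wxx) {t : ℝ} (ht : 0 ≤ t) (x : ℝ) :
    HasDerivAt (fun y => η t y * w t y) (-ηt t x) x :=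
  ((h.deriv_ηx t x).mul (h.deriv_wx t x)).congr_deriv (by linarith [h.mass_eq t x ht])

lemma hasDerivAt_momFlux (h : IsFlow a γ ν η w ηt ηx wt wx wxx) {t : ℝ} (ht : 0 ≤ t) (x : ℝ) :
    HasDerivAt (momFlux a γ ν η w wx t) (-(ηt t x * w t x + η t x * wt t x)) x := by
  have h1 := (((h.deriv_ηx t x).mul ((h.deriv_wx t x).pow 2)).sub
    ((h.deriv_wxx t x).const_mul ν)).add
    (((h.deriv_ηx t x).rpow_const (p := γ) (Or.inl (h.pos t x ht).ne')).const_mul a)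
  refine h1.congr_deriv ?_
  have e1 := h.mass_eq t x ht
  have e2 := h.mom_eq t x ht
  simp only [Pi.pow_apply]
  push_cast
  linear_combination w t x * e1 + e2

lemma hasDerivAt_mom (h : IsFlow a γ ν η w ηt ηx wt wx wxx) (t x : ℝ) :
    HasDerivAt (fun s => η s x * w s x) (ηt t x * w t x + η t x * wt t x) t :=
  (h.deriv_ηt t x).mul (h.deriv_wt t x)

lemma hasDerivAt_integral_η (h : IsFlow a γ ν η w ηt ηx wt wx wxx) {t : ℝ} (ht : 0 < t)
    (b c : ℝ) :
    HasDerivAt (fun s => ∫ x in b..c, η s x) (η t b * w t b - η t c * w t c) t := by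
  refine (hasDerivAt_integral_param h.cont_η.continuousOn h.cont_ηt.continuousOn
    (fun s x _ => h.deriv_ηt s x) ht b c).congr_deriv ?_
  have := intervalIntegral.integral_eq_sub_of_hasDerivAt (a := b) (b := c)
    (fun x _ => h.hasDerivAt_massFlux ht.le x)
    (Continuous.intervalIntegrable (by have := h.cont_ηt; fun_prop) _ _)
  rw [intervalIntegral.integral_neg] at this
  linarith

lemma hasDerivAt_integral_mom (h : IsFlow a γ ν η w ηt ηx wt wx wxx) {t : ℝ} (ht : 0 < t)
    (b c : ℝ) :
    HasDerivAt (fun s => ∫ x in b..c, η s x * w s x)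
      (momFlux a γ ν η w wx t b - momFlux a γ ν η w wx t c) t := by
  have := h.cont_η
  have := h.cont_w
  have := h.cont_ηt
  have := h.cont_wt
  refine (hasDerivAt_integral_param (G := fun s x => η s x * w s x)
    (G' := fun s x => ηt s x * w s x + η s x * wt s x)
    (by fun_prop) (by fun_prop) (fun s x _ => h.hasDerivAt_mom s x) ht b c).congr_deriv ?_
  have := intervalIntegral.integral_eq_sub_of_hasDerivAt (a := b) (b := c)
    (fun x _ => h.hasDerivAt_momFlux ht.le x)
    (Continuous.intervalIntegrable (by fun_prop) _ _)
  rw [intervalIntegral.integral_neg] at this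
  linarith

lemma mass (h : IsFlow a γ ν η w ηt ηx wt wx wxx) {t : ℝ} (ht : 0 ≤ t) :
    ∫ x in (0 : ℝ)..1, η t x = 1 := by
  refine (eq_initial_of_deriv_zero (f := fun t => ∫ x in (0 : ℝ)..1, η t x)
    (continuousOn_integral_param h.cont_η.continuousOn 0 1) (fun s hs => ?_) ht).trans h.mass_init
  refine (h.hasDerivAt_integral_η hs 0 1).congr_deriv ?_
  have e1 := h.per_η s 0
  have e2 := h.per_w s 0
  rw [zero_add] at e1 e2
  rw [e1, e2, sub_self]

lemma mom (h : IsFlow a γ ν η w ηt ηx wt wx wxx) {t : ℝ} (ht : 0 ≤ t) :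
    ∫ x in (0 : ℝ)..1, η t x * w t x = 0 := by
  have := h.cont_η
  have := h.cont_w
  refine (eq_initial_of_deriv_zero (f := fun t => ∫ x in (0 : ℝ)..1, η t x * w t x)
    (continuousOn_integral_param (G := fun t x => η t x * w t x) (by fun_prop) 0 1)
    (fun s hs => ?_) ht).trans h.mom_init
  refine (h.hasDerivAt_integral_mom hs 0 1).congr_deriv ?_
  have e1 := h.per_momFlux s 0
  rw [zero_add] at e1
  rw [e1, sub_self]

lemma hasDerivAt_integral_weighted_mom (h : IsFlow a γ ν η w ηt ηx wt wx wxx) {t : ℝ}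
    (ht : 0 < t) :
    HasDerivAt (fun s => ∫ x in (0 : ℝ)..1, (1 - x) * (η s x * w s x))
      (momFlux a γ ν η w wx t 0 - ∫ x in (0 : ℝ)..1, momFlux a γ ν η w wx t x) t := by
  have := h.cont_η
  have := h.cont_w
  have := h.cont_ηt
  have := h.cont_wt
  have hF := continuous_slice h.continuousOn_momFlux ht.le
  refine (hasDerivAt_integral_param (G := fun s x => (1 - x) * (η s x * w s x))
    (G' := fun s x => (1 - x) * (ηt s x * w s x + η s x * wt s x))
    (by fun_prop) (by fun_prop) (fun s x _ => (h.hasDerivAt_mom s x).const_mul _) ht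
    0 1).congr_deriv ?_
  have hd : ∀ x, HasDerivAt (fun y => (1 - y) * momFlux a γ ν η w wx t y)
      (-momFlux a γ ν η w wx t x - (1 - x) * (ηt t x * w t x + η t x * wt t x)) x := fun x =>
    (((hasDerivAt_id x).const_sub 1).mul (h.hasDerivAt_momFlux ht.le x)).congr_deriv
      (by simp only [id]; ring)
  have := intervalIntegral.integral_eq_sub_of_hasDerivAt (a := 0) (b := 1) (fun x _ => hd x)
    (Continuous.intervalIntegrable (by fun_prop) _ _)
  rw [intervalIntegral.integral_sub, intervalIntegral.integral_neg] at this
  · linarith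
  all_goals apply Continuous.intervalIntegrable; fun_prop

/-- The total energy is dissipated by viscosity. -/
lemma hasDerivAt_energy (h : IsFlow a γ ν η w ηt ηx wt wx wxx) {t : ℝ} (ht : 0 < t) :
    HasDerivAt (fun s => ∫ x in (0 : ℝ)..1, ((1 / 2) * η s x * w s x ^ 2 + Ppot a γ (η s x)))
      (-(ν * ∫ x in (0 : ℝ)..1, wx t x ^ 2)) t := by
  have := h.cont_η
  have := h.cont_w
  have := h.cont_ηt
  have := h.cont_wt
  have hwx := h.cont_wx
  have := h.continuousOn_Ppot_η
  have hP := h.continuousOn_enthalpy_η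
  have hc' : ContinuousOn (Function.uncurry fun s x => (1 / 2) * ηt s x * w s x ^ 2
      + η s x * w s x * wt s x + enthalpy a γ (η s x) * ηt s x) (Set.Ici 0 ×ˢ Set.univ) := by
    unfold Function.uncurry at *; fun_prop
  refine (hasDerivAt_integral_param
    (G := fun s x => (1 / 2) * η s x * w s x ^ 2 + Ppot a γ (η s x))
    (by unfold Function.uncurry at *; fun_prop) hc' (fun s x hs => ?_) ht 0 1).congr_deriv ?_
  · have := (((h.deriv_ηt s x).const_mul (1 / 2)).mul ((h.deriv_wt s x).pow 2)).add
      ((hasDerivAt_Ppot a γ (h.pos s x hs.le)).comp s (h.deriv_ηt s x))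
    refine this.congr_deriv ?_
    simp only [Pi.pow_apply]
    push_cast
    ring
  · have hd : ∀ x, HasDerivAt (fun y => ν * (w t y * wx t y) - (1 / 2) * (η t y * w t y) * w t y ^ 2
        - η t y * w t y * enthalpy a γ (η t y))
        (((1 / 2) * ηt t x * w t x ^ 2 + η t x * w t x * wt t x
          + enthalpy a γ (η t x) * ηt t x) + ν * wx t x ^ 2) x := fun x => by
      have hm := h.hasDerivAt_massFlux ht.le x
      have := ((((h.deriv_wx t x).mul (h.deriv_wxx t x)).const_mul ν).sub
        ((hm.const_mul (1 / 2)).mul ((h.deriv_wx t x).pow 2))).sub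
        (hm.mul ((hasDerivAt_enthalpy a γ (h.pos t x ht.le)).comp x (h.deriv_ηx t x)))
      refine this.congr_deriv ?_
      have e2 := h.mom_eq t x ht.le
      have e3 : η t x ^ (γ - 1) = η t x * η t x ^ (γ - 2) := by
        rw [show γ - 1 = 1 + (γ - 2) by ring, Real.rpow_add (h.pos t x ht.le), Real.rpow_one]
      rw [e3] at e2
      simp only [Pi.pow_apply, Function.comp]
      push_cast
      linear_combination (-w t x) * e2
    have hz := integral_deriv_eq_zero_of_eq hd (by
      have := continuous_slice hc' ht.le
      fun_prop) (by
      have e1 := h.per_η t 0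
      have e2 := h.per_w t 0
      have e3 := h.per_wx t 0
      rw [zero_add] at e1 e2 e3
      simp only [e1, e2, e3])
    rw [intervalIntegral.integral_add, intervalIntegral.integral_const_mul] at hz
    · linarith
    · exact (continuous_slice hc' ht.le).intervalIntegrable _ _
    · apply Continuous.intervalIntegrable; fun_prop

lemma energy_le_init (h : IsFlow a γ ν η w ηt ηx wt wx wxx) (hν : 0 ≤ ν) {t : ℝ} (ht : 0 ≤ t) :
    ∫ x in (0 : ℝ)..1, ((1 / 2) * η t x * w t x ^ 2 + Ppot a γ (η t x)) ≤
      ∫ x in (0 : ℝ)..1, ((1 / 2) * η 0 x * w 0 x ^ 2 + Ppot a γ (η 0 x)) := by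
  have := h.cont_η
  have := h.cont_w
  have := h.continuousOn_Ppot_η
  refine le_initial_of_deriv_nonpos
    (f := fun t => ∫ x in (0 : ℝ)..1, ((1 / 2) * η t x * w t x ^ 2 + Ppot a γ (η t x)))
    (continuousOn_integral_param
      (G := fun s x => (1 / 2) * η s x * w s x ^ 2 + Ppot a γ (η s x))
      (by unfold Function.uncurry at *; fun_prop) 0 1)
    (fun s hs => h.hasDerivAt_energy hs) (fun s _ => ?_) ht
  have : 0 ≤ ∫ x in (0 : ℝ)..1, wx s x ^ 2 :=
    intervalIntegral.integral_nonneg zero_le_one fun x _ => sq_nonneg _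
  have := mul_nonneg hν this
  linarith

/-- The functional pairing the momentum with the primitive of the density fluctuation. -/
lemma hasDerivAt_cross (h : IsFlow a γ ν η w ηt ηx wt wx wxx) {t : ℝ} (ht : 0 < t) :
    HasDerivAt (fun s => ∫ x in (0 : ℝ)..1, η s x * w s x * ∫ y in (0 : ℝ)..x, (η s y - 1))
      (∫ x in (0 : ℝ)..1, (a * η t x ^ γ * (η t x - 1) - η t x * w t x ^ 2
        - ν * (wx t x * (η t x - 1)))) t := by
  have hη := h.cont_η
  have hw := h.cont_w
  have := h.cont_ηt
  have := h.cont_wt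
  have := h.cont_wx
  have hF := continuous_slice h.continuousOn_momFlux ht.le
  have hpow := continuous_slice (G := fun s x => η s x ^ γ) (h.continuousOn_rpow_η γ) ht.le
  set φ : ℝ → ℝ → ℝ := fun s x => ∫ y in (0 : ℝ)..x, (η s y - 1) with hφ
  have hφc : Continuous (Function.uncurry φ) :=
    intervalIntegral.continuous_parametric_primitive_of_continuous
      (f := fun s y => η s y - 1) (by fun_prop)
  have hφt : ∀ s x, 0 < s → HasDerivAt (fun r => φ r x) (η s 0 * w s 0 - η s x * w s x) s :=
    fun s x hs => by
      have e : (fun r => φ r x) = fun r => (∫ y in (0 : ℝ)..x, η r y) - x := by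
        ext r
        simp only [hφ]
        rw [intervalIntegral.integral_sub]
        · simp
        all_goals apply Continuous.intervalIntegrable; fun_prop
      rw [e]
      exact (h.hasDerivAt_integral_η hs 0 x).sub_const x
  have hφx : ∀ x, HasDerivAt (φ t) (η t x - 1) x := fun x =>
    (show Continuous fun y => η t y - 1 by fun_prop).integral_hasStrictDerivAt 0 x |>.hasDerivAt
  have hφ0 : φ t 0 = 0 := by simp [hφ]
  have hφ1 : φ t 1 = 0 := by
    simp only [hφ]
    rw [intervalIntegral.integral_sub, h.mass ht.le]
    · simp
    all_goals apply Continuous.intervalIntegrable; fun_prop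
  refine (hasDerivAt_integral_param (G := fun s x => η s x * w s x * φ s x)
    (G' := fun s x => (ηt s x * w s x + η s x * wt s x) * φ s x
      + η s x * w s x * (η s 0 * w s 0 - η s x * w s x))
    (by fun_prop) (by fun_prop) (fun s x hs => (h.hasDerivAt_mom s x).mul (hφt s x hs)) ht
    0 1).congr_deriv ?_
  have hd : ∀ x, HasDerivAt (fun y => momFlux a γ ν η w wx t y * φ t y)
      (-(ηt t x * w t x + η t x * wt t x) * φ t x + momFlux a γ ν η w wx t x * (η t x - 1)) x :=
    fun x => (h.hasDerivAt_momFlux ht.le x).mul (hφx x)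
  have hz := integral_deriv_eq_zero_of_eq hd (by fun_prop) (by simp [hφ0, hφ1])
  have hm : ∫ x in (0 : ℝ)..1, η t 0 * w t 0 * (η t x * w t x) = 0 := by
    rw [intervalIntegral.integral_const_mul, h.mom ht.le, mul_zero]
  calc _ = (∫ x in (0 : ℝ)..1, (ηt t x * w t x + η t x * wt t x) * φ t x
        + η t x * w t x * (η t 0 * w t 0 - η t x * w t x))
        + (∫ x in (0 : ℝ)..1, -(ηt t x * w t x + η t x * wt t x) * φ t x
          + momFlux a γ ν η w wx t x * (η t x - 1))
        - ∫ x in (0 : ℝ)..1, η t 0 * w t 0 * (η t x * w t x) := by rw [hz, hm]; ring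
    _ = _ := by
      rw [← intervalIntegral.integral_add, ← intervalIntegral.integral_sub]
      · refine intervalIntegral.integral_congr fun x _ => ?_
        simp only [momFlux]
        ring
      all_goals apply Continuous.intervalIntegrable; fun_prop

lemma kinetic_add_pressure_le (h : IsFlow a γ ν η w ηt ηx wt wx wxx) (ha : 0 < a) (hγ1 : 1 ≤ γ)
    (hγ2 : γ ≤ 2) {t : ℝ} (ht : 0 ≤ t) :
    ∫ x in (0 : ℝ)..1, (η t x * w t x ^ 2 + a * η t x ^ γ) ≤
      2 * ∫ x in (0 : ℝ)..1, ((1 / 2) * η t x * w t x ^ 2 + Ppot a γ (η t x)) := by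
  have := h.cont_η
  have := h.cont_w
  have hpow := continuous_slice (G := fun s x => η s x ^ γ) (h.continuousOn_rpow_η γ) ht
  have hP := continuous_slice (G := fun s x => Ppot a γ (η s x)) h.continuousOn_Ppot_η ht
  rw [← intervalIntegral.integral_const_mul]
  refine intervalIntegral.integral_mono_on zero_le_one ?_ ?_ fun x _ => ?_
  · apply Continuous.intervalIntegrable; fun_prop
  · apply Continuous.intervalIntegrable; fun_prop
  · have h0 := h.pos t x ht
    have h1 := pressure_le_Ppot ha hγ1 hγ2 h0
    have h2 : 0 < a * η t x ^ γ := by positivity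
    linarith

lemma integral_abs_mom_le (h : IsFlow a γ ν η w ηt ηx wt wx wxx) {t : ℝ} (ht : 0 ≤ t) :
    2 * ∫ x in (0 : ℝ)..1, |η t x * w t x| ≤ 1 + ∫ x in (0 : ℝ)..1, η t x * w t x ^ 2 := by
  have := h.cont_η
  have := h.cont_w
  have e : 1 + ∫ x in (0 : ℝ)..1, η t x * w t x ^ 2
      = ∫ x in (0 : ℝ)..1, (η t x + η t x * w t x ^ 2) := by
    rw [intervalIntegral.integral_add, h.mass ht]
    all_goals apply Continuous.intervalIntegrable; fun_prop
  rw [e, ← intervalIntegral.integral_const_mul]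
  refine intervalIntegral.integral_mono_on zero_le_one ?_ ?_ fun x _ => ?_
  · apply Continuous.intervalIntegrable; fun_prop
  · apply Continuous.intervalIntegrable; fun_prop
  · have h0 := h.pos t x ht
    rw [abs_mul, abs_of_pos h0, ← sq_abs (w t x)]
    nlinarith [mul_nonneg h0.le (sq_nonneg (|w t x| - 1))]

/-- Uniform upper bound for the density. -/
lemma density_le (h : IsFlow a γ ν η w ηt ηx wt wx wxx) (ha : 0 < a) (hγ1 : 1 ≤ γ)
    (hγ2 : γ ≤ 2) (hν : 0 < ν) {E ς : ℝ} (hς : 0 < ς) (hE0 : 0 < E) (hη0 : ∀ x, η 0 x ≤ ς)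
    (hE : ∫ x in (0 : ℝ)..1, ((1 / 2) * η 0 x * w 0 x ^ 2 + Ppot a γ (η 0 x)) ≤ E)
    {T x : ℝ} (hT : 0 ≤ T) (hx : x ∈ Set.Icc (0 : ℝ) 1) :
    η T x ≤ (1 + ς + 2 * E / a) * Real.exp (2 * (1 + 2 * E) / ν) := by
  have hη := h.cont_η
  have hw := h.cont_w
  have hwx := h.cont_wx
  have hEt : ∀ t, 0 ≤ t → ∫ x in (0 : ℝ)..1, (η t x * w t x ^ 2 + a * η t x ^ γ) ≤ 2 * E :=
    fun t ht => (h.kinetic_add_pressure_le ha hγ1 hγ2 ht).trans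
      (by linarith [h.energy_le_init hν.le ht])
  have hkin : ∀ t, 0 ≤ t → ∫ x in (0 : ℝ)..1, η t x * w t x ^ 2 ≤ 2 * E := fun t ht => by
    have hpow := continuous_slice (G := fun s x => η s x ^ γ) (h.continuousOn_rpow_η γ) ht
    refine le_trans (intervalIntegral.integral_mono_on zero_le_one ?_ ?_ fun x _ => ?_) (hEt t ht)
    · apply Continuous.intervalIntegrable; fun_prop
    · apply Continuous.intervalIntegrable; fun_prop
    · have h0 := h.pos t x ht
      have : 0 < a * η t x ^ γ := by positivity
      linarith
  set ψ : ℝ → ℝ → ℝ := fun t x =>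
    (∫ y in (0 : ℝ)..x, η t y * w t y) - ∫ y in (0 : ℝ)..1, (1 - y) * (η t y * w t y) with hψ
  have hψc : Continuous (Function.uncurry ψ) := by
    have h1 : Continuous fun p : ℝ × ℝ => ∫ y in (0 : ℝ)..p.2, η p.1 y * w p.1 y :=
      intervalIntegral.continuous_parametric_primitive_of_continuous
        (f := fun s y => η s y * w s y) (by fun_prop)
    have h2 : Continuous fun t : ℝ => ∫ y in (0 : ℝ)..1, (1 - y) * (η t y * w t y) :=
      intervalIntegral.continuous_parametric_intervalIntegral_of_continuous'
        (f := fun s y => (1 - y) * (η s y * w s y)) (by fun_prop) 0 1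
    unfold Function.uncurry
    exact h1.sub (h2.comp continuous_fst)
  have hψb : ∀ t, 0 ≤ t → ∀ x ∈ Set.Icc (0 : ℝ) 1, |ψ t x| ≤ 1 + 2 * E := by
    intro t ht x hx
    have hc : Continuous fun y => η t y * w t y := by fun_prop
    have h1 := abs_integral_le_of_mem hc (Set.left_mem_Icc.2 zero_le_one) hx
    have h2 : |∫ y in (0 : ℝ)..1, (1 - y) * (η t y * w t y)|
        ≤ ∫ y in (0 : ℝ)..1, |η t y * w t y| := by
      refine (intervalIntegral.abs_integral_le_integral_abs zero_le_one).trans ?_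
      refine intervalIntegral.integral_mono_on zero_le_one ?_ ?_ fun y hy => ?_
      · apply Continuous.intervalIntegrable; fun_prop
      · apply Continuous.intervalIntegrable; fun_prop
      · rw [abs_mul]
        refine mul_le_of_le_one_left (abs_nonneg _) ?_
        rw [abs_of_nonneg (by linarith [hy.2])]
        linarith [hy.1]
    have h3 := h.integral_abs_mom_le ht
    have h4 := hkin t ht
    have h5 : |ψ t x| ≤ _ := abs_sub _ _
    linarith
  have hψt : ∀ t x, 0 < t → HasDerivAt (fun s => ψ s x)
      ((∫ y in (0 : ℝ)..1, (η t y * w t y ^ 2 + a * η t y ^ γ)) - momFlux a γ ν η w wx t x) t := by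
    intro t x ht
    refine ((h.hasDerivAt_integral_mom ht 0 x).sub
      (h.hasDerivAt_integral_weighted_mom ht)).congr_deriv ?_
    have hpow := continuous_slice (G := fun s x => η s x ^ γ) (h.continuousOn_rpow_η γ) ht.le
    have e : ∫ y in (0 : ℝ)..1, momFlux a γ ν η w wx t y
        = ∫ y in (0 : ℝ)..1, (η t y * w t y ^ 2 + a * η t y ^ γ) := by
      have hz := integral_deriv_eq_zero_of_eq (fun x => h.deriv_wx t x) (by fun_prop)
        (by simpa using h.per_w t 0)
      calc _ = (∫ y in (0 : ℝ)..1, ((η t y * w t y ^ 2 + a * η t y ^ γ) - ν * wx t y)) := by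
            refine intervalIntegral.integral_congr fun y _ => ?_
            simp only [momFlux]
            ring
        _ = _ := by
            rw [intervalIntegral.integral_sub, intervalIntegral.integral_const_mul, hz]
            · ring
            all_goals apply Continuous.intervalIntegrable; fun_prop
    rw [e]
    ring
  have hψx : ∀ t x, HasDerivAt (ψ t) (η t x * w t x) x := fun t x =>
    ((show Continuous fun y => η t y * w t y by fun_prop).integral_hasStrictDerivAt 0
      x).hasDerivAt.sub_const _
  have hψp : ∀ t, 0 ≤ t → Function.Periodic (ψ t) 1 := by
    intro t ht x
    have hp : Function.Periodic (fun y => η t y * w t y) 1 := fun y => by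
      simp only [h.per_η, h.per_w]
    have hc : Continuous fun y => η t y * w t y := by fun_prop
    have e1 := hp.intervalIntegral_add_eq x 0
    rw [zero_add, h.mom ht] at e1
    have e2 := intervalIntegral.integral_add_adjacent_intervals
      (hc.intervalIntegrable (μ := volume) 0 x) (hc.intervalIntegrable x (x + 1))
    simp only [hψ]
    rw [← e2, e1, add_zero]
  set M₀ := 1 + ς + 2 * E / a with hM₀
  have hEa : 0 < 2 * E / a := by positivity
  have hM₀pos : 0 < M₀ := by positivity
  set F : ℝ → ℝ → ℝ := fun t x => ψ t x + ν * Real.log (η t x) with hF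
  have hFc : ContinuousOn (Function.uncurry F) (Set.Icc 0 T ×ˢ Set.Icc 0 1) := by
    have h1 : ContinuousOn (fun p : ℝ × ℝ => Real.log (η p.1 p.2)) (Set.Ici 0 ×ˢ Set.univ) :=
      h.continuousOn_comp_η fun s hs => (Real.continuousAt_log (ne_of_gt hs)).continuousWithinAt
    have h2 : ContinuousOn (Function.uncurry F) (Set.Ici 0 ×ˢ Set.univ) := by
      unfold Function.uncurry at *
      fun_prop
    exact h2.mono (Set.prod_mono Set.Icc_subset_Ici_self (Set.subset_univ _))
  obtain ⟨⟨t₀, x₀⟩, ⟨ht₀, hx₀⟩, hmax⟩ := (isCompact_Icc.prod isCompact_Icc).exists_isMaxOn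
    ⟨(0, 0), ⟨Set.left_mem_Icc.2 hT, Set.left_mem_Icc.2 zero_le_one⟩⟩ hFc
  have hmax' : ∀ t ∈ Set.Icc 0 T, ∀ x ∈ Set.Icc (0 : ℝ) 1, F t x ≤ F t₀ x₀ :=
    fun t ht x hx => hmax (show (t, x) ∈ Set.Icc 0 T ×ˢ Set.Icc 0 1 from ⟨ht, hx⟩)
  simp only at ht₀ hx₀
  have hpos₀ := h.pos t₀ x₀ ht₀.1
  have hη₀ : η t₀ x₀ ≤ M₀ := by
    rcases eq_or_lt_of_le ht₀.1 with h0 | h0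
    · rw [← h0]
      linarith [hη0 x₀]
    · have hdx : HasDerivAt (F t₀) (η t₀ x₀ * w t₀ x₀ + ν * (ηx t₀ x₀ / η t₀ x₀)) x₀ :=
        (hψx t₀ x₀).add (((h.deriv_ηx t₀ x₀).log hpos₀.ne').const_mul ν)
      have hdt : HasDerivAt (fun s => F s x₀)
          ((∫ y in (0 : ℝ)..1, (η t₀ y * w t₀ y ^ 2 + a * η t₀ y ^ γ))
            - momFlux a γ ν η w wx t₀ x₀ + ν * (ηt t₀ x₀ / η t₀ x₀)) t₀ :=
        (hψt t₀ x₀ h0).add (((h.deriv_ηt t₀ x₀).log hpos₀.ne').const_mul ν)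
      have hFp : Function.Periodic (F t₀) 1 := fun y => by
        simp only [hF, h.per_η, (hψp t₀ h0.le) y]
      have hx0 : η t₀ x₀ * w t₀ x₀ + ν * (ηx t₀ x₀ / η t₀ x₀) = 0 := by
        refine IsLocalMax.hasDerivAt_eq_zero (Filter.Eventually.of_forall fun y => ?_) hdx
        obtain ⟨z, hz, e⟩ := hFp.exists_mem_Ico₀ one_pos y
        rw [e]
        exact hmax' t₀ ht₀ z ⟨hz.1, hz.2.le⟩
      have ht0 := deriv_nonneg_of_forall_le hdt h0 fun s hs =>
        hmax' s ⟨hs.1, hs.2.trans ht₀.2⟩ x₀ hx₀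
      have hmass := h.mass_eq t₀ x₀ h0.le
      have e1 : ηt t₀ x₀ / η t₀ x₀ = - wx t₀ x₀ - w t₀ x₀ * (ηx t₀ x₀ / η t₀ x₀) := by
        field_simp
        linarith
      have hle : a * η t₀ x₀ ^ γ ≤ 2 * E := by
        have h1 := hEt t₀ h0.le
        rw [e1] at ht0
        simp only [momFlux] at ht0
        have h2 : w t₀ x₀ * (η t₀ x₀ * w t₀ x₀ + ν * (ηx t₀ x₀ / η t₀ x₀)) = 0 := by
          rw [hx0, mul_zero]
        linarith
      rcases le_total (η t₀ x₀) 1 with h1 | h1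
      · linarith
      · have h2 := Real.rpow_le_rpow_of_exponent_le h1 hγ1
        rw [Real.rpow_one] at h2
        have h3 : η t₀ x₀ ≤ 2 * E / a := by
          rw [le_div_iff₀ ha]
          nlinarith
        linarith
  have hfin := hmax' T (Set.right_mem_Icc.2 hT) x hx
  have hlog := Real.log_le_log hpos₀ hη₀
  have hb1 := (abs_le.1 (hψb t₀ ht₀.1 x₀ hx₀)).2
  have hb2 := (abs_le.1 (hψb T hT x hx)).1
  have hposT := h.pos T x hT
  rw [← Real.log_le_log_iff hposT (by positivity), Real.log_mul hM₀pos.ne' (Real.exp_ne_zero _),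
    Real.log_exp]
  simp only [hF] at hfin
  have h6 : ν * Real.log (η T x) ≤ ν * (Real.log M₀ + 2 * (1 + 2 * E) / ν) := by
    have e : ν * (Real.log M₀ + 2 * (1 + 2 * E) / ν) = ν * Real.log M₀ + 2 * (1 + 2 * E) := by
      field_simp
    rw [e]
    nlinarith [mul_le_mul_of_nonneg_left hlog hν.le]
  exact le_of_mul_le_mul_left h6 hν

lemma relPot_integral_bounds (h : IsFlow a γ ν η w ηt ηx wt wx wxx) (ha : 0 < a) (hγ1 : 1 ≤ γ)
    (hγ2 : γ ≤ 2) {M t : ℝ} (hM : 1 ≤ M) (ht : 0 ≤ t)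
    (hηM : ∀ x ∈ Set.Icc (0 : ℝ) 1, η t x ≤ M) :
    a / (2 * M) * (∫ x in (0 : ℝ)..1, (η t x - 1) ^ 2) ≤
      (∫ x in (0 : ℝ)..1, ((1 / 2) * η t x * w t x ^ 2 + Ppot a γ (η t x)))
        - (1 / 2) * (∫ x in (0 : ℝ)..1, η t x * w t x ^ 2) - Ppot a γ 1 ∧
    (∫ x in (0 : ℝ)..1, ((1 / 2) * η t x * w t x ^ 2 + Ppot a γ (η t x)))
        - (1 / 2) * (∫ x in (0 : ℝ)..1, η t x * w t x ^ 2) - Ppot a γ 1 ≤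
      a * ∫ x in (0 : ℝ)..1, (η t x - 1) ^ 2 := by
  have := h.cont_η
  have := h.cont_w
  have hP := continuous_slice (G := fun s x => Ppot a γ (η s x)) h.continuousOn_Ppot_η ht
  have e : (∫ x in (0 : ℝ)..1, ((1 / 2) * η t x * w t x ^ 2 + Ppot a γ (η t x)))
        - (1 / 2) * (∫ x in (0 : ℝ)..1, η t x * w t x ^ 2) - Ppot a γ 1
      = ∫ x in (0 : ℝ)..1, (Ppot a γ (η t x) - Ppot a γ 1 - enthalpy a γ 1 * (η t x - 1)) := by
    have e1 : (∫ x in (0 : ℝ)..1, ((1 / 2) * η t x * w t x ^ 2 + Ppot a γ (η t x)))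
        = (1 / 2) * (∫ x in (0 : ℝ)..1, η t x * w t x ^ 2)
          + ∫ x in (0 : ℝ)..1, Ppot a γ (η t x) := by
      rw [← intervalIntegral.integral_const_mul, ← intervalIntegral.integral_add]
      · refine intervalIntegral.integral_congr fun x _ => ?_
        ring
      all_goals apply Continuous.intervalIntegrable; fun_prop
    rw [e1, intervalIntegral.integral_sub, intervalIntegral.integral_sub,
      intervalIntegral.integral_const_mul, intervalIntegral.integral_sub, h.mass ht]
    · simp
    all_goals apply Continuous.intervalIntegrable; fun_prop
  rw [e, ← intervalIntegral.integral_const_mul, ← intervalIntegral.integral_const_mul]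
  constructor
  · refine intervalIntegral.integral_mono_on zero_le_one ?_ ?_ fun x hx =>
      le_relPot ha hγ1 hγ2 (h.pos t x ht) hM (hηM x hx)
    all_goals apply Continuous.intervalIntegrable; fun_prop
  · refine intervalIntegral.integral_mono_on zero_le_one ?_ ?_ fun x hx =>
      relPot_le ha hγ1 hγ2 (h.pos t x ht)
    all_goals apply Continuous.intervalIntegrable; fun_prop

lemma abs_cross_le (h : IsFlow a γ ν η w ηt ηx wt wx wxx) {t : ℝ} (ht : 0 ≤ t) :
    |∫ x in (0 : ℝ)..1, η t x * w t x * ∫ y in (0 : ℝ)..x, (η t y - 1)| ≤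
      (1 / 2) * ((∫ x in (0 : ℝ)..1, η t x * w t x ^ 2)
        + ∫ x in (0 : ℝ)..1, (η t x - 1) ^ 2) := by
  have := h.cont_η
  have := h.cont_w
  have hc : Continuous fun y => η t y - 1 := by fun_prop
  have hφ : Continuous fun x => ∫ y in (0 : ℝ)..x, (η t y - 1) :=
    intervalIntegral.continuous_primitive (fun _ _ => hc.intervalIntegrable _ _) 0
  set N := ∫ x in (0 : ℝ)..1, (η t x - 1) ^ 2 with hN
  have hb : ∀ x ∈ Set.Icc (0 : ℝ) 1, (∫ y in (0 : ℝ)..x, (η t y - 1)) ^ 2 ≤ N := fun x hx => by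
    have h1 := abs_integral_le_of_mem hc (Set.left_mem_Icc.2 zero_le_one) hx
    rw [← sq_abs]
    exact (pow_le_pow_left₀ (abs_nonneg _) h1 2).trans (sq_integral_abs_le hc)
  have e : (1 / 2) * ((∫ x in (0 : ℝ)..1, η t x * w t x ^ 2) + N)
      = ∫ x in (0 : ℝ)..1, (1 / 2) * (η t x * w t x ^ 2 + η t x * N) := by
    rw [intervalIntegral.integral_const_mul, intervalIntegral.integral_add,
      intervalIntegral.integral_mul_const, h.mass ht, one_mul]
    all_goals apply Continuous.intervalIntegrable; fun_prop
  rw [e]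
  refine (intervalIntegral.abs_integral_le_integral_abs zero_le_one).trans ?_
  refine intervalIntegral.integral_mono_on zero_le_one ?_ ?_ fun x hx => ?_
  · apply Continuous.intervalIntegrable; fun_prop
  · apply Continuous.intervalIntegrable; fun_prop
  · have h0 := (h.pos t x ht).le
    have h1 := mul_le_mul_of_nonneg_left (hb x hx) h0
    set f := ∫ y in (0 : ℝ)..x, (η t y - 1)
    rw [abs_le]
    constructor
    · nlinarith [mul_nonneg h0 (sq_nonneg (w t x + f))]
    · nlinarith [mul_nonneg h0 (sq_nonneg (w t x - f))]

lemma cross_deriv_ge (h : IsFlow a γ ν η w ηt ηx wt wx wxx) (ha : 0 < a) (hγ1 : 1 ≤ γ) {t : ℝ}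
    (ht : 0 ≤ t) :
    a / 2 * (∫ x in (0 : ℝ)..1, (η t x - 1) ^ 2) - (∫ x in (0 : ℝ)..1, η t x * w t x ^ 2)
        - ν ^ 2 / (2 * a) * (∫ x in (0 : ℝ)..1, wx t x ^ 2) ≤
      ∫ x in (0 : ℝ)..1, (a * η t x ^ γ * (η t x - 1) - η t x * w t x ^ 2
        - ν * (wx t x * (η t x - 1))) := by
  have := h.cont_η
  have := h.cont_w
  have := h.cont_wx
  have hpow := continuous_slice (G := fun s x => η s x ^ γ) (h.continuousOn_rpow_η γ) ht
  have e : a / 2 * (∫ x in (0 : ℝ)..1, (η t x - 1) ^ 2) - (∫ x in (0 : ℝ)..1, η t x * w t x ^ 2)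
        - ν ^ 2 / (2 * a) * (∫ x in (0 : ℝ)..1, wx t x ^ 2)
      = ∫ x in (0 : ℝ)..1, (a / 2 * (η t x - 1) ^ 2 - η t x * w t x ^ 2
        - ν ^ 2 / (2 * a) * wx t x ^ 2 + a * (η t x - 1)) := by
    rw [intervalIntegral.integral_add, intervalIntegral.integral_sub,
      intervalIntegral.integral_sub, intervalIntegral.integral_const_mul,
      intervalIntegral.integral_const_mul, intervalIntegral.integral_const_mul,
      intervalIntegral.integral_sub, h.mass ht]
    · simp
    all_goals apply Continuous.intervalIntegrable; fun_prop
  rw [e]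
  refine intervalIntegral.integral_mono_on zero_le_one ?_ ?_ fun x hx => ?_
  · apply Continuous.intervalIntegrable; fun_prop
  · apply Continuous.intervalIntegrable; fun_prop
  · have h1 := sq_le_pressure_mul ha hγ1 (h.pos t x ht)
    have h2 : a / 2 * (η t x - 1) ^ 2 + ν ^ 2 / (2 * a) * wx t x ^ 2
        - ν * (wx t x * (η t x - 1)) = (a * (η t x - 1) - ν * wx t x) ^ 2 / (2 * a) := by
      field_simp
      ring
    have h3 : 0 ≤ (a * (η t x - 1) - ν * wx t x) ^ 2 / (2 * a) := by positivity
    linarith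

/-- Exponential decay of the kinetic energy and of the density fluctuation, with explicit rate. -/
lemma decay (h : IsFlow a γ ν η w ηt ηx wt wx wxx) (ha : 0 < a) (hγ1 : 1 ≤ γ) (hγ2 : γ ≤ 2)
    {M c δ β : ℝ} (hM : 1 ≤ M)
    (hηM : ∀ t, 0 ≤ t → ∀ x ∈ Set.Icc (0 : ℝ) 1, η t x ≤ M) (hc : c = a / (2 * M))
    (hδ0 : 0 < δ) (hδ1 : δ ≤ 1 / 2) (hδc : δ ≤ c) (hδν : δ * (ν ^ 2 / (2 * a) + 1) ≤ ν / 2)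
    (hβ0 : 0 < β) (hβ1 : β ≤ ν / 2) (hβ2 : β * (a + 1) ≤ δ * a / 2) {t : ℝ} (ht : 0 ≤ t) :
    (1 / 4) * (∫ x in (0 : ℝ)..1, η t x * w t x ^ 2)
        + c / 2 * (∫ x in (0 : ℝ)..1, (η t x - 1) ^ 2) ≤
      (2 + (a + 1) / c) * (∫ x in (0 : ℝ)..1, ((1 / 2) * η 0 x * w 0 x ^ 2 + Ppot a γ (η 0 x)))
        * Real.exp (-β * t) := by
  have hcpos : 0 < c := by rw [hc]; positivity
  have hη := h.cont_η
  have hw := h.cont_w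
  have hEc : ContinuousOn (fun t => ∫ x in (0 : ℝ)..1,
      ((1 / 2) * η t x * w t x ^ 2 + Ppot a γ (η t x))) (Set.Ici 0) := by
    have := h.continuousOn_Ppot_η
    exact continuousOn_integral_param
      (G := fun s x => (1 / 2) * η s x * w s x ^ 2 + Ppot a γ (η s x))
      (by unfold Function.uncurry at *; fun_prop) 0 1
  have hXc : ContinuousOn (fun t => ∫ x in (0 : ℝ)..1,
      η t x * w t x * ∫ y in (0 : ℝ)..x, (η t y - 1)) (Set.Ici 0) := by
    have hφc : Continuous (Function.uncurry fun t x => ∫ y in (0 : ℝ)..x, (η t y - 1)) :=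
      intervalIntegral.continuous_parametric_primitive_of_continuous
        (f := fun s y => η s y - 1) (by fun_prop)
    exact continuousOn_integral_param
      (G := fun t x => η t x * w t x * ∫ y in (0 : ℝ)..x, (η t y - 1)) (by fun_prop) 0 1
  have hP1 : 0 < Ppot a γ 1 := lt_of_lt_of_le (by simpa using ha)
    (pressure_le_Ppot ha hγ1 hγ2 one_pos)
  exact decay_of_corrected_energy hEc hXc (fun s hs => h.hasDerivAt_energy hs)
    (fun s hs => h.hasDerivAt_cross hs) (fun s hs => h.cross_deriv_ge ha hγ1 hs)
    (fun s hs => h.abs_cross_le hs)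
    (fun s hs => hc ▸ (h.relPot_integral_bounds ha hγ1 hγ2 hM hs (hηM s hs)).1)
    (fun s hs => (h.relPot_integral_bounds ha hγ1 hγ2 hM hs (hηM s hs)).2)
    (fun s hs => intervalIntegral.integral_nonneg zero_le_one fun x _ =>
      mul_nonneg (h.pos s x hs).le (sq_nonneg _))
    (fun s _ => intervalIntegral.integral_nonneg zero_le_one fun x _ => sq_nonneg _)
    (fun s hs => weighted_sq_le (by fun_prop) (fun x => (h.pos s x hs).le) (h.deriv_wx s)
      (by have := h.cont_wx; fun_prop) (h.mass hs) (h.mom hs))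
    ha hP1.le hcpos hδ0 hδ1 hδc hδν hβ0 hβ1 hβ2 ht

end IsFlow

/-- A smooth function of two variables has smooth partial derivatives. -/
lemma exists_smooth_partials {f : ℝ → ℝ → ℝ} (hf : ContDiff ℝ (⊤ : ℕ∞) (Function.uncurry f)) :
    ∃ ft fx : ℝ → ℝ → ℝ, ContDiff ℝ (⊤ : ℕ∞) (Function.uncurry ft) ∧
      ContDiff ℝ (⊤ : ℕ∞) (Function.uncurry fx) ∧
      (∀ t x, HasDerivAt (fun s => f s x) (ft t x) t) ∧
      (∀ t x, HasDerivAt (f t) (fx t x) x) := by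
  have hd : ContDiff ℝ (⊤ : ℕ∞) (fderiv ℝ (Function.uncurry f)) := hf.fderiv_right (by simp)
  have hdiff : ∀ t x, HasFDerivAt (Function.uncurry f) (fderiv ℝ (Function.uncurry f) (t, x))
      (t, x) := fun t x => (hf.differentiable (by simp)).differentiableAt.hasFDerivAt
  refine ⟨fun t x => fderiv ℝ (Function.uncurry f) (t, x) (1, 0),
    fun t x => fderiv ℝ (Function.uncurry f) (t, x) (0, 1), hd.clm_apply contDiff_const,
    hd.clm_apply contDiff_const, fun t x => ?_, fun t x => ?_⟩
  · exact (hdiff t x).comp_hasDerivAt t ((hasDerivAt_id t).prodMk (hasDerivAt_const t x))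
  · exact (hdiff t x).comp_hasDerivAt x ((hasDerivAt_const x t).prodMk (hasDerivAt_id x))

lemma sqrt_le_of_le_mul_exp {Y A B E β t : ℝ} (hA : 0 < A) (hB : 0 < B)
    (h : A * Y ≤ B * E * Real.exp (-β * t)) :
    Real.sqrt Y ≤ Real.sqrt (B / A) * Real.sqrt E * Real.exp (-(β / 2) * t) := by
  have e : Real.exp (-β * t) = Real.exp (-(β / 2) * t) ^ 2 := by
    rw [← Real.exp_nat_mul]
    congr 1
    push_cast
    ring
  have h1 : Y ≤ B / A * E * Real.exp (-(β / 2) * t) ^ 2 := by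
    rw [← e]
    calc Y ≤ B * E * Real.exp (-β * t) / A := by rw [le_div_iff₀ hA]; linarith
      _ = _ := by ring
  refine (Real.sqrt_le_sqrt h1).trans_eq ?_
  rw [Real.sqrt_mul' _ (sq_nonneg _), Real.sqrt_sq (Real.exp_pos _).le,
    Real.sqrt_mul (by positivity)]

/-- **Exponential decay of the basic energy** (Proposition `prop-decay-exp-L2`):
there are `C, α > 0`, depending only on `(a, γ, ν, ς̄₀, Ē)`, such that every
global smooth solution of the 1D isentropic compressible Navier–Stokes system
on `[0,∞) × 𝕋` with `0 < η₀ ≤ ς̄₀`, `∫_𝕋 η₀ = 1`, `∫_𝕋 η₀ w₀ = 0` and initial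
energy `E₀₀ ≤ Ē` satisfies
`‖η^{1/2} w(t)‖_{L²} + ‖η(t) - 1‖_{L²} ≤ C E₀₀^{1/2} e^{-α t}` for all `t ≥ 0`.
Functions on `𝕋 = ℝ/ℤ` are modelled as `1`-periodic functions of `x`. -/
theorem basic_energy_decay (a γ ν ςbar Ebar : ℝ)
    (ha : 0 < a) (hγ1 : 1 ≤ γ) (hγ2 : γ ≤ 2) (hν : 0 < ν)
    (hςbar : 0 < ςbar) (hEbar : 0 < Ebar) :
    ∃ C α : ℝ, 0 < C ∧ 0 < α ∧
      ∀ η w : ℝ → ℝ → ℝ,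
        ContDiff ℝ (⊤ : ℕ∞) (Function.uncurry η) →
        ContDiff ℝ (⊤ : ℕ∞) (Function.uncurry w) →
        (∀ t x : ℝ, η t (x + 1) = η t x) →
        (∀ t x : ℝ, w t (x + 1) = w t x) →
        (∀ t x : ℝ, 0 ≤ t → 0 < η t x) →
        (∀ t x : ℝ, 0 ≤ t →
          deriv (fun s => η s x) t + deriv (fun y => η t y * w t y) x = 0) →
        (∀ t x : ℝ, 0 ≤ t →
          η t x * (deriv (fun s => w s x) t + w t x * deriv (w t) x)
            - ν * deriv (deriv (w t)) x + deriv (fun y => a * η t y ^ γ) x = 0) →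
        (∀ x : ℝ, η 0 x ≤ ςbar) →
        (∫ x in (0:ℝ)..1, η 0 x) = 1 →
        (∫ x in (0:ℝ)..1, η 0 x * w 0 x) = 0 →
        (∫ x in (0:ℝ)..1, ((1 / 2) * η 0 x * (w 0 x) ^ 2 + Ppot a γ (η 0 x))) ≤ Ebar →
        ∀ t : ℝ, 0 ≤ t →
          Real.sqrt (∫ x in (0:ℝ)..1, η t x * (w t x) ^ 2)
            + Real.sqrt (∫ x in (0:ℝ)..1, (η t x - 1) ^ 2)
          ≤ C * Real.sqrt (∫ x in (0:ℝ)..1,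
                ((1 / 2) * η 0 x * (w 0 x) ^ 2 + Ppot a γ (η 0 x)))
              * Real.exp (-α * t) := by
  set M := (1 + ςbar + 2 * Ebar / a) * Real.exp (2 * (1 + 2 * Ebar) / ν) with hMdef
  have hM : 1 ≤ M := by
    have h1 : 0 < 2 * Ebar / a := by positivity
    exact one_le_mul_of_one_le_of_one_le (by linarith) (Real.one_le_exp (by positivity))
  obtain ⟨c, hc⟩ : ∃ c, c = a / (2 * M) := ⟨_, rfl⟩
  have hc0 : 0 < c := by rw [hc]; positivity
  have hq : 0 < ν ^ 2 / (2 * a) + 1 := by positivity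
  obtain ⟨δ, hδ⟩ : ∃ δ, δ = min (min (1 / 2) c) (ν / 2 / (ν ^ 2 / (2 * a) + 1)) := ⟨_, rfl⟩
  have hδ0 : 0 < δ := by rw [hδ]; positivity
  have hδ1 : δ ≤ 1 / 2 := by rw [hδ]; exact (min_le_left _ _).trans (min_le_left _ _)
  have hδc : δ ≤ c := by rw [hδ]; exact (min_le_left _ _).trans (min_le_right _ _)
  have hδν : δ * (ν ^ 2 / (2 * a) + 1) ≤ ν / 2 := by
    rw [← le_div_iff₀ hq, hδ]
    exact min_le_right _ _
  obtain ⟨β, hβ⟩ : ∃ β, β = min (ν / 2) (δ * a / 2 / (a + 1)) := ⟨_, rfl⟩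
  have hβ0 : 0 < β := by rw [hβ]; positivity
  have hβ1 : β ≤ ν / 2 := by rw [hβ]; exact min_le_left _ _
  have hβ2 : β * (a + 1) ≤ δ * a / 2 := by
    rw [← le_div_iff₀ (by positivity), hβ]
    exact min_le_right _ _
  have hB : 0 < 2 + (a + 1) / c := by positivity
  refine ⟨Real.sqrt ((2 + (a + 1) / c) / (1 / 4)) + Real.sqrt ((2 + (a + 1) / c) / (c / 2)), β / 2,
    by positivity, by positivity, ?_⟩
  intro η w hη hw hηp hwp hpos hmass hmom hς hm1 hm0 hE t ht
  obtain ⟨ηt, ηx, hηt, hηx, dηt, dηx⟩ := exists_smooth_partials hη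
  obtain ⟨wt, wx, hwt, hwx, dwt, dwx⟩ := exists_smooth_partials hw
  obtain ⟨wxt, wxx, -, hwxx, -, dwxx⟩ := exists_smooth_partials hwx
  have h : IsFlow a γ ν η w ηt ηx wt wx wxx :=
    { cont_η := hη.continuous
      cont_w := hw.continuous
      cont_ηt := hηt.continuous
      cont_ηx := hηx.continuous
      cont_wt := hwt.continuous
      cont_wx := hwx.continuous
      cont_wxx := hwxx.continuous
      deriv_ηt := dηt
      deriv_ηx := dηx
      deriv_wt := dwt
      deriv_wx := dwx
      deriv_wxx := dwxx
      per_η := hηp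
      per_w := hwp
      pos := hpos
      mass_eq := fun s x hs => by
        have := hmass s x hs
        rwa [(dηt s x).deriv, ((dηx s x).fun_mul (dwx s x)).deriv] at this
      mom_eq := fun s x hs => by
        have := hmom s x hs
        rw [(dwt s x).deriv, show deriv (w s) = wx s from funext fun y => (dwx s y).deriv,
          (dwxx s x).deriv,
          (((dηx s x).rpow_const (p := γ) (Or.inl (hpos s x hs).ne')).const_mul a).deriv] at this
        linarith
      mass_init := hm1
      mom_init := hm0 }
  have key := h.decay ha hγ1 hγ2 hM
    (fun s hs x hx => h.density_le ha hγ1 hγ2 hν hςbar hEbar hς hE hs hx)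
    hc hδ0 hδ1 hδc hδν hβ0 hβ1 hβ2 ht
  have hK0 : 0 ≤ ∫ x in (0 : ℝ)..1, η t x * w t x ^ 2 :=
    intervalIntegral.integral_nonneg zero_le_one fun x _ =>
      mul_nonneg (hpos t x ht).le (sq_nonneg _)
  have hN0 : 0 ≤ ∫ x in (0 : ℝ)..1, (η t x - 1) ^ 2 :=
    intervalIntegral.integral_nonneg zero_le_one fun x _ => sq_nonneg _
  have hcN := mul_nonneg (half_pos hc0).le hN0
  have h1 := sqrt_le_of_le_mul_exp (A := 1 / 4) (by norm_num) hB
    ((le_add_of_nonneg_right hcN).trans key)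
  have h2 := sqrt_le_of_le_mul_exp (half_pos hc0) hB
    ((le_add_of_nonneg_left (by positivity)).trans key)
  rw [add_mul, add_mul]
  exact add_le_add h1 h2
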